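/- Fix γ ∈ (−1,1). The function x ↦ sin θ_*(x) lies in the kernel of the Schrödinger operator L_γ = −∂ₓₓ + (1−γ²)(cos²θ_* − sin²θ_*): for every x ∈ ℝ, −(sin θ_*)″(x) + (1−γ²)·(cos²θ_*(x) − sin²θ_*(x))·sin θ_*(x) = 0. -/

import Mathlib

open MeasureTheory Filter ENNReal

noncomputable section

abbrev E3 := EuclideanSpace ℝ (Fin 3)

/-- canonical basis vectors of ℝ³ -/
def e1 : E3 := !₂[1, 0, 0]
def e2 : E3 := !₂[0, 1, 0]
def e3 : E3 := !₂[0, 0, 1]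

/-- cross product in ℝ³ -/
def cross3 (a b : E3) : E3 :=
  !₂[a 1 * b 2 - a 2 * b 1, a 2 * b 0 - a 0 * b 2, a 0 * b 1 - a 1 * b 0]

/-- scalar product in ℝ³ -/
def dot3 (a b : E3) : ℝ := a 0 * b 0 + a 1 * b 1 + a 2 * b 2

/-- θ_*(x) = 2 arctan (exp (−√(1−γ²) x)) -/
def thetaStar (γ x : ℝ) : ℝ := 2 * Real.arctan (Real.exp (-Real.sqrt (1 - γ ^ 2) * x))

/-- φ_*(x) = −γ x -/
def phiStar (γ x : ℝ) : ℝ := -γ * x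

/-- the domain walls w_*^± (s = ±1 is the sign) -/
def wStar (γ s x : ℝ) : E3 :=
  !₂[Real.cos (thetaStar γ x),
    s * (Real.sin (thetaStar γ x) * Real.cos (phiStar γ x)),
    s * (Real.sin (thetaStar γ x) * Real.sin (phiStar γ x))]

/-- rotation about the axis e₁ by angle φ -/
def rot (φ : ℝ) (v : E3) : E3 :=
  !₂[v 0, v 1 * Real.cos φ - v 2 * Real.sin φ, v 1 * Real.sin φ + v 2 * Real.cos φ]

/-- the energy gradient δE(m) = −m″ − 2γ e₁ ∧ m′ + m₂e₂ + m₃e₃ -/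
def deltaE (γ : ℝ) (m : ℝ → E3) (x : ℝ) : E3 :=
  -(deriv (deriv m) x) - (2 * γ) • cross3 e1 (deriv m x) + (m x 1) • e2 + (m x 2) • e3

/-- the L² norm of a function on ℝ -/
def L2norm {E : Type*} [NormedAddCommGroup E] (u : ℝ → E) : ℝ :=
  (eLpNorm u 2 volume).toReal

/-- the H¹ norm ‖u‖_{L²} + ‖u′‖_{L²} -/
def H1norm {E : Type*} [NormedAddCommGroup E] [NormedSpace ℝ E] (u : ℝ → E) : ℝ :=
  L2norm u + L2norm (deriv u)

/-- the ℋ¹ seminorm ‖m₂‖_{L²} + ‖m₃‖_{L²} + ‖m′‖_{L²} -/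
def HH1 (m : ℝ → E3) : ℝ :=
  L2norm (fun x => m x 1) + L2norm (fun x => m x 2) + L2norm (deriv m)

/-- the micromagnetic energy E(m) -/
def energy (γ : ℝ) (m : ℝ → E3) : ℝ :=
  (1 / 2) * ∫ x : ℝ,
    (‖deriv m x‖ ^ 2 + 2 * γ * dot3 (deriv m x) (cross3 e1 (m x)) + (1 - (m x 0) ^ 2))

/-- The profile equation θ_*′ = −√(1−γ²) sin θ_*. -/
theorem hasDerivAt_thetaStar_aux (γ x : ℝ) :
    HasDerivAt (thetaStar γ) (-Real.sqrt (1 - γ ^ 2) * Real.sin (thetaStar γ x)) x := by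
  have h1 : HasDerivAt (fun y : ℝ => -Real.sqrt (1 - γ ^ 2) * y) (-Real.sqrt (1 - γ ^ 2)) x := by
    simpa using (hasDerivAt_id x).const_mul (-Real.sqrt (1 - γ ^ 2))
  have h2 := (h1.exp.arctan).const_mul 2
  have h3 : Real.sin (thetaStar γ x) = 2 * Real.exp (-Real.sqrt (1 - γ ^ 2) * x)
      / (1 + Real.exp (-Real.sqrt (1 - γ ^ 2) * x) ^ 2) := by
    unfold thetaStar
    generalize Real.exp (-Real.sqrt (1 - γ ^ 2) * x) = u
    have hu : 0 < 1 + u ^ 2 := by positivity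
    rw [Real.sin_two_mul, Real.sin_arctan, Real.cos_arctan]
    have hs := Real.sq_sqrt hu.le
    have hp := Real.sqrt_pos.mpr hu
    field_simp
    rw [hs]
  refine HasDerivAt.congr_deriv (f := thetaStar γ) h2 ?_
  rw [h3]
  ring

/-- sin θ_* lies in the kernel of L_γ = −∂ₓₓ + (1−γ²)(cos²θ_* − sin²θ_*). -/
theorem sin_thetaStar_kernel (γ : ℝ) (hγ : -1 < γ ∧ γ < 1) (x : ℝ) :
    -(deriv (deriv (fun y => Real.sin (thetaStar γ y))) x)
      + (1 - γ ^ 2) * (Real.cos (thetaStar γ x) ^ 2 - Real.sin (thetaStar γ x) ^ 2)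
          * Real.sin (thetaStar γ x) = 0 := by
  have hk : Real.sqrt (1 - γ ^ 2) ^ 2 = 1 - γ ^ 2 := Real.sq_sqrt (by nlinarith [hγ.1, hγ.2])
  have hd : deriv (fun y => Real.sin (thetaStar γ y)) = fun y =>
      Real.cos (thetaStar γ y) * (-Real.sqrt (1 - γ ^ 2) * Real.sin (thetaStar γ y)) := by
    funext y
    exact (hasDerivAt_thetaStar_aux γ y).sin.deriv
  have ht := hasDerivAt_thetaStar_aux γ x
  have h2 := (ht.cos.mul (ht.sin.const_mul (-Real.sqrt (1 - γ ^ 2)))).deriv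
  rw [hd]
  refine (congrArg (fun d => -d + _) h2).trans ?_
  linear_combination (-(Real.cos (thetaStar γ x) ^ 2 - Real.sin (thetaStar γ x) ^ 2)
    * Real.sin (thetaStar γ x)) * hk
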